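/- arXiv:2106.11183 — 2 statements merged into one kernel-verified Lean document; each statement's English description precedes it below -/
import Mathlib

section
/- Let X₁,…,Xₙ be smooth vector fields on ℝⁿ, let p ∈ ℝⁿ, and let u be a smooth real-valued function on a neighborhood of p. For t ∈ ℝⁿ near 0, let Θ_p(t) = γ_t(1), where γ_t is the unique solution of the ODE system γ′(s) = Σᵢ₌₁ⁿ tᵢ Xᵢ(γ(s)) with γ(0) = p. Then, as t → 0, u(Θ_p(t)) = u(p) + ⟨D_𝔛u(p), t⟩ + ½⟨(D_𝔛²u(p))* t, t⟩ + o(|t|²). -/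
open Asymptotics

/-- A second order Taylor estimate: if the second derivative of `v` stays within `δ` of `c` on
`[0, 1]`, then `v 1` differs from `v 0 + v' 0 + c / 2` by at most `δ`. -/
theorem abs_taylor_two_sub_le {v v' v'' : ℝ → ℝ} {c δ : ℝ}
    (hv : ∀ s ∈ Set.Icc (0 : ℝ) 1, HasDerivAt v (v' s) s)
    (hv' : ∀ s ∈ Set.Icc (0 : ℝ) 1, HasDerivAt v' (v'' s) s)
    (hδ : ∀ s ∈ Set.Icc (0 : ℝ) 1, |v'' s - c| ≤ δ) :
    |v 1 - v 0 - v' 0 - (1 / 2) * c| ≤ δ := by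
  have hδ0 : 0 ≤ δ := (abs_nonneg _).trans (hδ 0 (by simp))
  have first : ∀ s ∈ Set.Icc (0 : ℝ) 1, |v' s - v' 0 - c * s| ≤ δ := by
    intro s hs
    have := norm_image_sub_le_of_norm_deriv_le_segment' (f := fun s => v' s - c * s)
      (f' := fun s => v'' s - c) (a := 0) (b := 1) (C := δ)
      (fun x hx => by
        refine (((hv' x hx).sub ((hasDerivAt_id x).const_mul c)).congr_deriv ?_).hasDerivWithinAt
        rw [mul_one])
      (fun x hx => hδ x (Set.Ico_subset_Icc_self hx)) s hs
    simp only [Real.norm_eq_abs, mul_zero, sub_zero] at this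
    rw [sub_right_comm]
    exact this.trans (mul_le_of_le_one_right hδ0 hs.2)
  have := norm_image_sub_le_of_norm_deriv_le_segment'
    (f := fun s => v s - v' 0 * s - c / 2 * s ^ 2)
    (f' := fun s => v' s - v' 0 - c * s) (a := 0) (b := 1) (C := δ)
    (fun x hx => by
      have h := ((hv x hx).sub ((hasDerivAt_id x).const_mul (v' 0))).sub
        ((hasDerivAt_pow 2 x).const_mul (c / 2))
      refine (h.congr_deriv ?_).hasDerivWithinAt
      norm_num
      ring)
    (fun x hx => first x (Set.Ico_subset_Icc_self hx)) 1 (by simp)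
  rw [Real.norm_eq_abs] at this
  calc _ = |v 1 - v' 0 * 1 - c / 2 * 1 ^ 2 - (v 0 - v' 0 * 0 - c / 2 * 0 ^ 2)| := by
        congr 1
        ring
    _ ≤ δ * (1 - 0) := this
    _ = δ := by ring

/-- A curve on `[0, 1]` whose speed is less than `r` as long as it is within distance `r` of its
starting point stays within distance `r` of it. -/
theorem mem_closedBall_of_norm_deriv_lt {E : Type*} [NormedAddCommGroup E] [NormedSpace ℝ E]
    {g g' : ℝ → E} {p : E} {r : ℝ} (hr : 0 ≤ r) (h0 : g 0 = p)
    (hg : ∀ s ∈ Set.Icc (0 : ℝ) 1, HasDerivAt g (g' s) s)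
    (hlt : ∀ s ∈ Set.Icc (0 : ℝ) 1, g s ∈ Metric.closedBall p r → ‖g' s‖ < r) :
    ∀ s ∈ Set.Icc (0 : ℝ) 1, g s ∈ Metric.closedBall p r := by
  intro s hs
  have := image_norm_le_of_norm_deriv_right_lt_deriv_boundary (f := fun s => g s - p)
    (f' := g') (a := 0) (b := 1) (B := fun s => r * s) (B' := fun _ => r)
    (fun x hx => ((hg x hx).sub_const p).continuousAt.continuousWithinAt)
    (fun x hx => ((hg x (Set.Ico_subset_Icc_self hx)).sub_const p).hasDerivWithinAt)
    (by simp [h0]) (fun x => by simpa using (hasDerivAt_id x).const_mul r)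
    (fun x hx hx' => hlt x (Set.Ico_subset_Icc_self hx) (by
      rw [mem_closedBall_iff_norm, hx']
      exact mul_le_of_le_one_right hr hx.2.le)) hs
  rw [mem_closedBall_iff_norm]
  exact this.trans (mul_le_of_le_one_right hr hs.2)

theorem abs_coord_le_norm {n : ℕ} (t : EuclideanSpace ℝ (Fin n)) (i : Fin n) : |t i| ≤ ‖t‖ :=
  PiLp.norm_apply_le t i

/-- A quadratic form whose coefficients are bounded by `ε` is bounded by `n ^ 2 * ε * ‖t‖ ^ 2`. -/
theorem abs_sum_sum_mul_le {n : ℕ} (t : EuclideanSpace ℝ (Fin n)) {A : Fin n → Fin n → ℝ} {ε : ℝ}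
    (hA : ∀ i j, |A i j| ≤ ε) : |∑ i, ∑ j, A i j * t i * t j| ≤ n ^ 2 * ε * ‖t‖ ^ 2 := by
  calc |∑ i, ∑ j, A i j * t i * t j| ≤ ∑ i, ∑ j, |A i j * t i * t j| :=
        (Finset.abs_sum_le_sum_abs _ _).trans
          (Finset.sum_le_sum fun i _ => Finset.abs_sum_le_sum_abs _ _)
    _ ≤ ∑ _i : Fin n, ∑ _j : Fin n, ε * ‖t‖ * ‖t‖ := by
        refine Finset.sum_le_sum fun i _ => Finset.sum_le_sum fun j _ => ?_
        have := (abs_nonneg _).trans (hA i j)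
        rw [abs_mul, abs_mul]
        gcongr
        exacts [hA i j, abs_coord_le_norm t i, abs_coord_le_norm t j]
    _ = n ^ 2 * ε * ‖t‖ ^ 2 := by
        simp only [Finset.sum_const, Finset.card_univ, Fintype.card_fin, nsmul_eq_mul]
        ring

theorem sum_sum_symm_mul {n : ℕ} (A : Fin n → Fin n → ℝ) (t : Fin n → ℝ) :
    ∑ i, ∑ j, ((A i j + A j i) / 2) * t i * t j = ∑ i, ∑ j, A i j * t i * t j := by
  have h : ∑ i, ∑ j, A j i * t i * t j = ∑ i, ∑ j, A i j * t i * t j := by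
    rw [Finset.sum_comm]
    exact Finset.sum_congr rfl fun i _ => Finset.sum_congr rfl fun j _ => by ring
  calc _ = (∑ i, ∑ j, A i j * t i * t j + ∑ i, ∑ j, A j i * t i * t j) / 2 := by
        simp only [← Finset.sum_add_distrib, Finset.sum_div]
        exact Finset.sum_congr rfl fun i _ => Finset.sum_congr rfl fun j _ => by ring
    _ = _ := by rw [h]; ring

/-- The derivative of a smooth function along a smooth vector field is smooth. -/
theorem ContDiffOn.fderiv_apply_vectorField {E : Type*} [NormedAddCommGroup E] [NormedSpace ℝ E]
    {u : E → ℝ} {Y : E → E} {V : Set E} (hV : IsOpen V) (hu : ContDiffOn ℝ (⊤ : ℕ∞) u V)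
    (hY : ContDiff ℝ (⊤ : ℕ∞) Y) : ContDiffOn ℝ (⊤ : ℕ∞) (fun y => fderiv ℝ u y (Y y)) V :=
  (hu.fderiv_of_isOpen hV (by simp)).clm_apply hY.contDiffOn

/-- The derivative of `u` along a solution of `γ' = ∑ i, t i • X i γ`. -/
theorem hasDerivAt_comp_flow {n : ℕ} {E : Type*} [NormedAddCommGroup E] [NormedSpace ℝ E]
    {X : Fin n → E → E} {u : E → ℝ} {g : ℝ → E} {t : Fin n → ℝ} {s : ℝ}
    (hu : DifferentiableAt ℝ u (g s)) (hg : HasDerivAt g (∑ i, t i • X i (g s)) s) :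
    HasDerivAt (fun s => u (g s)) (∑ i, fderiv ℝ u (g s) (X i (g s)) * t i) s := by
  refine (hu.hasFDerivAt.comp_hasDerivAt s hg).congr_deriv ?_
  simp [map_sum, mul_comm]

/-- Taylor's theorem adapted to a frame of smooth vector fields (NSW85).
Let `X₁,…,Xₙ` be smooth vector fields on `ℝⁿ`, `p ∈ ℝⁿ`, and let `u` be smooth on a
neighborhood of `p`.  For `t` near `0` let `Θ_p(t) = γ_t(1)`, where `γ_t` solves
`γ′(s) = Σᵢ tᵢ Xᵢ(γ(s))`, `γ(0) = p`.  Then, as `t → 0`,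
`u(Θ_p(t)) = u(p) + ⟨D_𝔛u(p), t⟩ + ½⟨(D²_𝔛u(p))* t, t⟩ + o(|t|²)`. -/
theorem stmt0 {n : ℕ}
    (X : Fin n → EuclideanSpace ℝ (Fin n) → EuclideanSpace ℝ (Fin n))
    (hX : ∀ i, ContDiff ℝ (⊤ : ℕ∞) (X i))
    (p : EuclideanSpace ℝ (Fin n))
    (u : EuclideanSpace ℝ (Fin n) → ℝ)
    (V : Set (EuclideanSpace ℝ (Fin n))) (hV : IsOpen V) (hpV : p ∈ V)
    (hu : ContDiffOn ℝ (⊤ : ℕ∞) u V)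
    (W : Set (EuclideanSpace ℝ (Fin n))) (hW : W ∈ nhds (0 : EuclideanSpace ℝ (Fin n)))
    (γ : EuclideanSpace ℝ (Fin n) → ℝ → EuclideanSpace ℝ (Fin n))
    (Θ : EuclideanSpace ℝ (Fin n) → EuclideanSpace ℝ (Fin n))
    (hγ0 : ∀ t ∈ W, γ t 0 = p)
    (hγ' : ∀ t ∈ W, ∀ s ∈ Set.Icc (0 : ℝ) 1,
      HasDerivAt (γ t) (∑ i, t i • X i (γ t s)) s)
    (hΘ : ∀ t ∈ W, Θ t = γ t 1) :
    (fun t : EuclideanSpace ℝ (Fin n) =>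
        u (Θ t) - u p - (∑ i, fderiv ℝ u p (X i p) * t i)
          - (1 / 2) * ∑ i, ∑ j,
              ((fderiv ℝ (fun y => fderiv ℝ u y (X j y)) p (X i p)
                + fderiv ℝ (fun y => fderiv ℝ u y (X i y)) p (X j p)) / 2) * t i * t j)
      =o[nhds 0] fun t => ‖t‖ ^ 2 := by
  set Y : Fin n → EuclideanSpace ℝ (Fin n) → ℝ := fun j y => fderiv ℝ u y (X j y)
  set Z : Fin n → Fin n → EuclideanSpace ℝ (Fin n) → ℝ :=
    fun i j y => fderiv ℝ (Y j) y (X i y)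
  have hY : ∀ j, ContDiffOn ℝ (⊤ : ℕ∞) (Y j) V := fun j => hu.fderiv_apply_vectorField hV (hX j)
  have hZ : ∀ i j, ContDiffOn ℝ (⊤ : ℕ∞) (Z i j) V :=
    fun i j => (hY j).fderiv_apply_vectorField hV (hX i)
  have hVp : V ∈ nhds p := hV.mem_nhds hpV
  rw [isLittleO_iff]
  intro c hc
  obtain ⟨ε, hε, hεc⟩ : ∃ ε > 0, (n : ℝ) ^ 2 * ε ≤ c :=
    ⟨c / ((n : ℝ) ^ 2 + 1), by positivity, by
      rw [mul_div_assoc', div_le_iff₀ (by positivity)]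
      nlinarith⟩
  have hnear : ∀ᶠ y in nhds p, y ∈ V ∧ (∀ i j, |Z i j y - Z i j p| ≤ ε) ∧
      ∀ i, ‖X i y‖ ≤ ‖X i p‖ + 1 := by
    refine Filter.Eventually.and hVp (Filter.Eventually.and ?_ ?_)
    · refine Filter.eventually_all.2 fun i => Filter.eventually_all.2 fun j => ?_
      have := ((hZ i j).continuousOn.continuousAt hVp).eventually (Metric.closedBall_mem_nhds _ hε)
      simpa [Real.dist_eq] using this
    · refine Filter.eventually_all.2 fun i => ?_
      exact ((hX i).continuous.norm.continuousAt.eventually_lt continuousAt_const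
        (lt_add_one _)).mono fun y hy => hy.le
  obtain ⟨r, hr, hball⟩ := Metric.nhds_basis_closedBall.eventually_iff.1 hnear
  set M : ℝ := ∑ i, (‖X i p‖ + 1)
  have hsmall : ∀ᶠ t : EuclideanSpace ℝ (Fin n) in nhds 0, ‖t‖ * M < r := by
    have h : ContinuousAt (fun t : EuclideanSpace ℝ (Fin n) => ‖t‖ * M) 0 := by fun_prop
    exact h.eventually_lt continuousAt_const (by simpa using hr)
  filter_upwards [hW, hsmall] with t htW ht
  have hmem : ∀ s ∈ Set.Icc (0 : ℝ) 1, γ t s ∈ Metric.closedBall p r := by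
    refine mem_closedBall_of_norm_deriv_lt hr.le (hγ0 t htW) (hγ' t htW) fun s _ hs => ?_
    refine lt_of_le_of_lt ?_ ht
    rw [Finset.mul_sum]
    refine (norm_sum_le _ _).trans (Finset.sum_le_sum fun i _ => ?_)
    rw [norm_smul]
    exact mul_le_mul (abs_coord_le_norm t i) ((hball hs).2.2 i) (norm_nonneg _) (norm_nonneg _)
  have hd : ∀ f : EuclideanSpace ℝ (Fin n) → ℝ, ContDiffOn ℝ (⊤ : ℕ∞) f V →
      ∀ s ∈ Set.Icc (0 : ℝ) 1, HasDerivAt (fun s => f (γ t s))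
        (∑ i, fderiv ℝ f (γ t s) (X i (γ t s)) * t i) s := fun f hf s hs =>
    hasDerivAt_comp_flow ((hf.contDiffAt (hV.mem_nhds (hball (hmem s hs)).1)).differentiableAt
      (by simp)) (hγ' t htW s hs)
  have key := abs_taylor_two_sub_le (v := fun s => u (γ t s))
    (v' := fun s => ∑ j, Y j (γ t s) * t j)
    (v'' := fun s => ∑ j, (∑ i, Z i j (γ t s) * t i) * t j)
    (c := ∑ i, ∑ j, Z i j p * t i * t j) (δ := n ^ 2 * ε * ‖t‖ ^ 2)
    (hd u hu)
    (fun s hs => HasDerivAt.fun_sum fun j _ => (hd (Y j) (hY j) s hs).mul_const (t j))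
    (fun s hs => by
      convert abs_sum_sum_mul_le t (hball (hmem s hs)).2.1 using 2
      simp only [Finset.sum_mul, sub_mul, Finset.sum_sub_distrib]
      rw [Finset.sum_comm])
  rw [sum_sum_symm_mul (fun i j => Z i j p), hΘ t htW, Real.norm_eq_abs, norm_pow, norm_norm]
  simp only [hγ0 t htW] at key
  exact key.trans (by gcongr)
end

section
/- In the doubled frame setting, let d : U → ℝ be smooth and strictly positive on an open set U ⊆ ℝⁿ×ℝⁿ and satisfy the eikonal hypotheses, and let α ∈ ℝ. Then at every point of U: ⟨D_𝔷²(d^α) · D_𝔷(d^α), D_𝔷(d^α)⟩ = 4α³(α−1) d^{3α−4}, and likewise ⟨(D_𝔷²(d^α))* · D_𝔷(d^α), D_𝔷(d^α)⟩ = 4α³(α−1) d^{3α−4}. -/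
open Matrix

noncomputable section

/-- Doubled frame on `ℝⁿ × ℝⁿ`: `Z (inl i) (x,y) = (Xᵢ(x), 0)` and
`Z (inr i) (x,y) = (0, Xᵢ(y))`. -/
def Zf {n : ℕ} (X : Fin n → (Fin n → ℝ) → (Fin n → ℝ)) :
    (Fin n ⊕ Fin n) → (Fin n → ℝ) × (Fin n → ℝ) → (Fin n → ℝ) × (Fin n → ℝ)
  | Sum.inl i, p => (X i p.1, 0)
  | Sum.inr i, p => (0, X i p.2)

/-- Frame gradient `D_𝔷 d` of `d` at `p`, as a vector in `ℝ²ⁿ`. -/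
def Dz {n : ℕ} (X : Fin n → (Fin n → ℝ) → (Fin n → ℝ))
    (d : (Fin n → ℝ) × (Fin n → ℝ) → ℝ) (p : (Fin n → ℝ) × (Fin n → ℝ)) :
    (Fin n ⊕ Fin n) → ℝ :=
  fun i => fderiv ℝ d p (Zf X i p)

/-- Frame second derivative `D²_𝔷 d` of `d` at `p`: the `2n × 2n` matrix with
`(i,j)`-entry `Zᵢ(Zⱼd)(p)`. -/
def Dz2 {n : ℕ} (X : Fin n → (Fin n → ℝ) → (Fin n → ℝ))
    (d : (Fin n → ℝ) × (Fin n → ℝ) → ℝ) (p : (Fin n → ℝ) × (Fin n → ℝ)) :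
    Matrix (Fin n ⊕ Fin n) (Fin n ⊕ Fin n) ℝ :=
  fun i j => fderiv ℝ (fun q => fderiv ℝ d q (Zf X j q)) p (Zf X i p)

/-- Symmetrized frame second derivative `(D²_𝔷 d)* = ½(D²_𝔷 d + (D²_𝔷 d)ᵗ)`. -/
def Dz2Sym {n : ℕ} (X : Fin n → (Fin n → ℝ) → (Fin n → ℝ))
    (d : (Fin n → ℝ) × (Fin n → ℝ) → ℝ) (p : (Fin n → ℝ) × (Fin n → ℝ)) :
    Matrix (Fin n ⊕ Fin n) (Fin n ⊕ Fin n) ℝ :=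
  (1 / 2 : ℝ) • (Dz2 X d p + (Dz2 X d p)ᵀ)

/-- The eikonal hypotheses: `Σᵢ₌₁ⁿ (Zᵢd)² = 1` and `Σᵢ₌ₙ₊₁²ⁿ (Zᵢd)² = 1` on `U`. -/
def EikonalHyp {n : ℕ} (X : Fin n → (Fin n → ℝ) → (Fin n → ℝ))
    (d : (Fin n → ℝ) × (Fin n → ℝ) → ℝ)
    (U : Set ((Fin n → ℝ) × (Fin n → ℝ))) : Prop :=
  ∀ p ∈ U, (∑ i : Fin n, (Dz X d p (Sum.inl i)) ^ 2 = 1) ∧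
    (∑ i : Fin n, (Dz X d p (Sum.inr i)) ^ 2 = 1)

/-- The frame field `Z j` is as smooth as the vector fields generating it. -/
lemma contDiff_Zf {n : ℕ} {k : WithTop ℕ∞} {X : Fin n → (Fin n → ℝ) → (Fin n → ℝ)}
    (hX : ∀ i, ContDiff ℝ k (X i)) (j : Fin n ⊕ Fin n) : ContDiff ℝ k (Zf X j) := by
  cases j with
  | inl i => exact ((hX i).comp contDiff_fst).prodMk contDiff_const
  | inr i => exact contDiff_const.prodMk ((hX i).comp contDiff_snd)

/-- The frame gradient of a `C²` function is differentiable. -/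
lemma differentiableAt_Dz {n : ℕ} {X : Fin n → (Fin n → ℝ) → (Fin n → ℝ)}
    (hX : ∀ i, ContDiff ℝ 1 (X i)) {g : (Fin n → ℝ) × (Fin n → ℝ) → ℝ}
    {p : (Fin n → ℝ) × (Fin n → ℝ)} (hg : ContDiffAt ℝ 2 g p) (j : Fin n ⊕ Fin n) :
    DifferentiableAt ℝ (fun q => Dz X g q j) p :=
  ((hg.fderiv_right (m := 1) (by norm_num)).differentiableAt one_ne_zero).clm_apply
    ((contDiff_Zf hX j).differentiable one_ne_zero p)

/-- Differentiating `|D_𝔷 g|²` along `Z i` gives `2 (D²_𝔷 g · D_𝔷 g)ᵢ`. -/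
lemma fderiv_dotProduct_Dz {n : ℕ} {X : Fin n → (Fin n → ℝ) → (Fin n → ℝ)}
    {g : (Fin n → ℝ) × (Fin n → ℝ) → ℝ} {p : (Fin n → ℝ) × (Fin n → ℝ)}
    (hg : ∀ j, DifferentiableAt ℝ (fun q => Dz X g q j) p) (i : Fin n ⊕ Fin n) :
    fderiv ℝ (fun q => Dz X g q ⬝ᵥ Dz X g q) p (Zf X i p) =
      2 * (Dz2 X g p).mulVec (Dz X g p) i := by
  have h : HasFDerivAt (fun q => ∑ j, Dz X g q j * Dz X g q j) _ p :=
    HasFDerivAt.fun_sum fun j _ => (hg j).hasFDerivAt.mul (hg j).hasFDerivAt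
  have h' : fderiv ℝ (fun q => Dz X g q ⬝ᵥ Dz X g q) p = _ := h.fderiv
  rw [h', _root_.sum_apply]
  simp only [mulVec, dotProduct, Finset.mul_sum]
  refine Finset.sum_congr rfl fun j _ => ?_
  change Dz X g p j * Dz2 X g p i j + Dz X g p j * Dz2 X g p i j = _
  ring

/-- Chain rule for the frame gradient of a real power. -/
lemma Dz_rpow {n : ℕ} (X : Fin n → (Fin n → ℝ) → (Fin n → ℝ))
    {d : (Fin n → ℝ) × (Fin n → ℝ) → ℝ} {p : (Fin n → ℝ) × (Fin n → ℝ)}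
    (hd : DifferentiableAt ℝ d p) (hp : d p ≠ 0) (α : ℝ) :
    Dz X (fun q => d q ^ α) p = (α * d p ^ (α - 1)) • Dz X d p := by
  ext j
  simp only [Dz, (hd.hasFDerivAt.rpow_const (Or.inl hp)).fderiv, Pi.smul_apply]
  rfl

/-- Under the eikonal hypotheses, `|D_𝔷 d|² = 2`. -/
lemma EikonalHyp.dotProduct_Dz {n : ℕ} {X : Fin n → (Fin n → ℝ) → (Fin n → ℝ)}
    {d : (Fin n → ℝ) × (Fin n → ℝ) → ℝ} {U : Set ((Fin n → ℝ) × (Fin n → ℝ))}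
    (h : EikonalHyp X d U) {p : (Fin n → ℝ) × (Fin n → ℝ)} (hp : p ∈ U) :
    Dz X d p ⬝ᵥ Dz X d p = 2 := by
  simp only [dotProduct, Fintype.sum_sum_type, ← sq]
  rw [(h p hp).1, (h p hp).2]
  norm_num

/-- Symmetrizing the frame second derivative does not change its quadratic form. -/
lemma Dz2Sym_mulVec_dotProduct {n : ℕ} (X : Fin n → (Fin n → ℝ) → (Fin n → ℝ))
    (g : (Fin n → ℝ) × (Fin n → ℝ) → ℝ) (p : (Fin n → ℝ) × (Fin n → ℝ))
    (v : Fin n ⊕ Fin n → ℝ) :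
    (Dz2Sym X g p).mulVec v ⬝ᵥ v = (Dz2 X g p).mulVec v ⬝ᵥ v := by
  have h : (Dz2 X g p)ᵀ.mulVec v ⬝ᵥ v = (Dz2 X g p).mulVec v ⬝ᵥ v := by
    rw [mulVec_transpose, ← dotProduct_mulVec, dotProduct_comm]
  rw [Dz2Sym, smul_mulVec, add_mulVec, smul_dotProduct, add_dotProduct, h, smul_eq_mul]
  ring

/-- In the doubled frame setting, if `d` is smooth and strictly positive on an
open `U ⊆ ℝⁿ×ℝⁿ` and satisfies the eikonal hypotheses, then for any `α ∈ ℝ`, at every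
point of `U`, `⟨D²_𝔷(d^α) · D_𝔷(d^α), D_𝔷(d^α)⟩ = 4α³(α−1) d^(3α−4)` and likewise with
the symmetrized second derivative. -/
theorem stmt6 {n : ℕ} (X : Fin n → (Fin n → ℝ) → (Fin n → ℝ))
    (hX : ∀ i, ContDiff ℝ (⊤ : ℕ∞) (X i))
    (U : Set ((Fin n → ℝ) × (Fin n → ℝ))) (hU : IsOpen U)
    (d : (Fin n → ℝ) × (Fin n → ℝ) → ℝ) (hd : ContDiffOn ℝ (⊤ : ℕ∞) d U)
    (hdpos : ∀ p ∈ U, 0 < d p)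
    (heik : EikonalHyp X d U) (α : ℝ) :
    ∀ p ∈ U,
      (Dz2 X (fun q => d q ^ α) p).mulVec (Dz X (fun q => d q ^ α) p) ⬝ᵥ
          Dz X (fun q => d q ^ α) p = 4 * α ^ 3 * (α - 1) * d p ^ (3 * α - 4) ∧
      (Dz2Sym X (fun q => d q ^ α) p).mulVec (Dz X (fun q => d q ^ α) p) ⬝ᵥ
          Dz X (fun q => d q ^ α) p = 4 * α ^ 3 * (α - 1) * d p ^ (3 * α - 4) := by
  intro p hp
  rw [Dz2Sym_mulVec_dotProduct, and_self]
  have hd_at : ∀ q ∈ U, ContDiffAt ℝ (⊤ : ℕ∞) d q := fun q hq =>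
    hd.contDiffAt (hU.mem_nhds hq)
  have hd_diff : ∀ q ∈ U, DifferentiableAt ℝ d q := fun q hq =>
    (hd_at q hq).differentiableAt (by simp)
  have hgrad : ∀ q ∈ U, Dz X (fun q => d q ^ α) q = (α * d q ^ (α - 1)) • Dz X d q :=
    fun q hq => Dz_rpow X (hd_diff q hq) (hdpos q hq).ne' α
  have hnorm : (fun q => Dz X (fun q => d q ^ α) q ⬝ᵥ Dz X (fun q => d q ^ α) q) =ᶠ[nhds p]
      fun q => 2 * α ^ 2 * d q ^ (2 * (α - 1)) := by
    filter_upwards [hU.mem_nhds hp] with q hq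
    rw [hgrad q hq, smul_dotProduct, dotProduct_smul, heik.dotProduct_Dz hq, two_mul (α - 1),
      Real.rpow_add (hdpos q hq)]
    simp only [smul_eq_mul]
    ring
  have hdiff : ∀ j, DifferentiableAt ℝ (fun q => Dz X (fun q => d q ^ α) q j) p :=
    differentiableAt_Dz (fun i => (hX i).of_le (by exact_mod_cast le_top))
      (((hd_at p hp).of_le (WithTop.coe_le_coe.2 (le_top : (2 : ℕ∞) ≤ ⊤))).rpow_const_of_ne (hdpos p hp).ne')
  have hmul : (Dz2 X (fun q => d q ^ α) p).mulVec (Dz X (fun q => d q ^ α) p) =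
      (2 * α ^ 2 * (α - 1) * d p ^ (2 * (α - 1) - 1)) • Dz X d p := by
    ext i
    have h := fderiv_dotProduct_Dz hdiff i
    rw [hnorm.fderiv_eq, (((hd_diff p hp).hasFDerivAt.rpow_const
      (Or.inl (hdpos p hp).ne')).const_mul (2 * α ^ 2)).fderiv] at h
    change 2 * α ^ 2 * (2 * (α - 1) * d p ^ (2 * (α - 1) - 1) * Dz X d p i) = _ at h
    rw [Pi.smul_apply, smul_eq_mul]
    linarith
  rw [hmul, hgrad p hp, smul_dotProduct, dotProduct_smul, heik.dotProduct_Dz hp,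
    show 3 * α - 4 = (2 * (α - 1) - 1) + (α - 1) by ring, Real.rpow_add (hdpos p hp)]
  simp only [smul_eq_mul]
  ring
end
end
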